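/- Let E_{2,4}(x_1,x_2,x_3,x_4) = x_1x_2 + x_1x_3 + x_1x_4 + x_2x_3 + x_2x_4 + x_3x_4. Then the function E_{2,4}^{-β} is completely monotone on (0,∞)^4 if and only if β = 0 or β ≥ 1. -/

import Mathlib

/-- The open positive orthant `(0,∞)^ι`. -/
def posOrthant (ι : Type*) : Set (ι → ℝ) := {x | ∀ i, 0 < x i}

/-- A function `f : (0,∞)^ι → ℝ` is completely monotone if it is `C^∞` on the open
orthant and `(−1)^k ∂^k f/(∂x_{i_1}···∂x_{i_k}) ≥ 0` there, for every `k ≥ 0` and all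
indices `i_1, …, i_k`. -/
def CompletelyMonotoneOnOrthant {ι : Type*} [Fintype ι] [DecidableEq ι]
    (f : (ι → ℝ) → ℝ) : Prop :=
  ContDiffOn ℝ (⊤ : ℕ∞) f (posOrthant ι) ∧
    ∀ (k : ℕ) (idx : Fin k → ι), ∀ x ∈ posOrthant ι,
      0 ≤ (-1 : ℝ) ^ k *
        iteratedFDerivWithin ℝ k f (posOrthant ι) x (fun j => Pi.single (idx j) (1 : ℝ))

open MeasureTheory Filter Topology

section Moments

/-- Log-convexity of a Hausdorff moment sequence, given through its iterated differences `a k m`. -/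
theorem hausdorff_moment_sq_le (a : ℕ → ℕ → ℝ) (ha : ∀ k m, 0 ≤ a k m)
    (hadd : ∀ k m, a (k + 1) m + a k (m + 1) = a k m) :
    a 1 0 ^ 2 ≤ a 0 0 * a 2 0 := by
  let L : Polynomial ℝ →ₗ[ℝ] ℝ :=
    Polynomial.lsum fun k => (LinearMap.id : ℝ →ₗ[ℝ] ℝ).smulRight (a k 0)
  have hLX : ∀ k, L (Polynomial.X ^ k) = a k 0 := fun k => by
    simp [L, Polynomial.X_pow_eq_monomial, Polynomial.sum_monomial_index]
  have hL : ∀ m k, L (Polynomial.X ^ k * (1 - Polynomial.X) ^ m) = a k m := by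
    intro m
    induction m with
    | zero => intro k; simpa using hLX k
    | succ m ih =>
      intro k
      have h : (Polynomial.X : Polynomial ℝ) ^ k * (1 - Polynomial.X) ^ (m + 1)
          = Polynomial.X ^ k * (1 - Polynomial.X) ^ m
            - Polynomial.X ^ (k + 1) * (1 - Polynomial.X) ^ m := by ring
      rw [h, map_sub, ih, ih]
      linarith [hadd k m]
  have hw : ∀ n k, 0 ≤ L (bernsteinPolynomial ℝ n k) := by
    intro n k
    have h : bernsteinPolynomial ℝ n k
        = (n.choose k : ℝ) • (Polynomial.X ^ k * (1 - Polynomial.X) ^ (n - k)) := by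
      rw [bernsteinPolynomial, Polynomial.smul_eq_C_mul]
      simp [mul_assoc]
    rw [h, map_smul, hL]
    exact mul_nonneg (Nat.cast_nonneg _) (ha _ _)
  have key : ∀ n : ℕ, (n * a 1 0) ^ 2 ≤ a 0 0 * (n * (n - 1) * a 2 0 + n * a 1 0) := by
    intro n
    have h0 := congrArg L (bernsteinPolynomial.sum ℝ n)
    have h1 := congrArg L (bernsteinPolynomial.sum_smul ℝ n)
    have h2 := congrArg L (bernsteinPolynomial.sum_mul_smul ℝ n)
    have e0 : L 1 = a 0 0 := by simpa using hLX 0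
    have e1 : L Polynomial.X = a 1 0 := by simpa using hLX 1
    rw [map_sum, e0] at h0
    simp only [map_sum, map_nsmul, e1] at h1
    simp only [map_sum, map_nsmul, hLX] at h2
    simp only [nsmul_eq_mul] at h1 h2
    have h2' : ∑ k ∈ Finset.range (n + 1), (k : ℝ) ^ 2 * L (bernsteinPolynomial ℝ n k)
        = n * (n - 1) * a 2 0 + n * a 1 0 := by
      have c : ∀ j : ℕ, ((j * (j - 1) : ℕ) : ℝ) = j * (j - 1) := by
        rintro (_ | j) <;> simp
      rw [← h1, ← c, ← h2, ← Finset.sum_add_distrib]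
      refine Finset.sum_congr rfl fun k _ => ?_
      rw [c]; ring
    rw [← h2', ← h1, ← h0]
    refine Finset.sum_sq_le_sum_mul_sum_of_sq_le_mul _ (fun k _ => hw n k)
      (fun k _ => mul_nonneg (sq_nonneg _) (hw n k)) fun k _ => le_of_eq (by ring)
  by_contra! hlt
  obtain ⟨n, hn⟩ := exists_nat_gt (a 0 0 * (a 1 0 - a 2 0) / (a 1 0 ^ 2 - a 0 0 * a 2 0))
  rw [div_lt_iff₀ (by linarith)] at hn
  have h := key (n + 1)
  push_cast at h
  have hn0 : (0 : ℝ) < n + 1 := by positivity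
  have h' : (n + 1 : ℝ) * ((n + 1) * (a 1 0 ^ 2 - a 0 0 * a 2 0) - a 0 0 * (a 1 0 - a 2 0)) ≤ 0 := by
    nlinarith
  have := nonpos_of_mul_nonpos_right h' hn0
  nlinarith

end Moments

section Orthant

variable {ι : Type*}

theorem isOpen_posOrthant [Finite ι] : IsOpen (posOrthant ι) := by
  simp only [posOrthant, Set.ofPred_forall]
  exact isOpen_iInter_of_finite fun i => isOpen_lt continuous_const (continuous_apply i)

theorem posOrthant_add_mem {x v : ι → ℝ} (hx : x ∈ posOrthant ι) (hv : ∀ i, 0 ≤ v i) :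
    x + v ∈ posOrthant ι := fun i => add_pos_of_pos_of_nonneg (hx i) (hv i)

variable [Fintype ι] [DecidableEq ι]

/-- Minus the `i`-th partial derivative. -/
noncomputable def negPartial (i : ι) (f : (ι → ℝ) → ℝ) (x : ι → ℝ) : ℝ :=
  - fderiv ℝ f x (Pi.single i 1)

theorem negPartial_congr {i : ι} {f g : (ι → ℝ) → ℝ} (h : Set.EqOn f g (posOrthant ι)) :
    Set.EqOn (negPartial i f) (negPartial i g) (posOrthant ι) := fun x hx => by
  rw [negPartial, negPartial,
    (h.eventuallyEq_of_mem (isOpen_posOrthant.mem_nhds hx)).fderiv_eq]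

theorem ContDiffOn.negPartial {i : ι} {f : (ι → ℝ) → ℝ}
    (hf : ContDiffOn ℝ (⊤ : ℕ∞) f (posOrthant ι)) :
    ContDiffOn ℝ (⊤ : ℕ∞) (negPartial i f) (posOrthant ι) :=
  ((hf.fderiv_of_isOpen isOpen_posOrthant (m := (⊤ : ℕ∞)) (by simp)).clm_apply
    contDiffOn_const).neg

theorem iteratedFDerivWithin_negPartial {f : (ι → ℝ) → ℝ}
    (hf : ContDiffOn ℝ (⊤ : ℕ∞) f (posOrthant ι)) (k : ℕ) (m : Fin k → ι → ℝ) (i : ι)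
    {x : ι → ℝ} (hx : x ∈ posOrthant ι) :
    iteratedFDerivWithin ℝ k (negPartial i f) (posOrthant ι) x m
      = - iteratedFDerivWithin ℝ (k + 1) f (posOrthant ι) x
          (Fin.snoc (α := fun _ => ι → ℝ) m (Pi.single i 1)) := by
  have hu := (isOpen_posOrthant (ι := ι)).uniqueDiffOn (𝕜 := ℝ)
  rw [iteratedFDerivWithin_succ_apply_right hu hx, Fin.init_snoc, Fin.snoc_last]
  have hc : Set.EqOn (negPartial i f)
      ((-(ContinuousLinearMap.apply ℝ ℝ (Pi.single i (1 : ℝ) : ι → ℝ))) ∘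
        fun y => fderivWithin ℝ f (posOrthant ι) y) (posOrthant ι) := fun y hy => by
    simp [negPartial, fderivWithin_of_isOpen isOpen_posOrthant hy]
  rw [iteratedFDerivWithin_congr hc hx,
    ContinuousLinearMap.iteratedFDerivWithin_comp_left (n := (⊤ : ℕ∞)) _
      ((hf.fderivWithin hu (m := (⊤ : ℕ∞)) (by simp)).contDiffWithinAt hx) hu hx
      (by exact_mod_cast le_top)]
  simp

namespace CompletelyMonotoneOnOrthant

variable {f g : (ι → ℝ) → ℝ}

theorem nonneg (hf : CompletelyMonotoneOnOrthant f) {x : ι → ℝ} (hx : x ∈ posOrthant ι) :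
    0 ≤ f x := by
  simpa using hf.2 0 Fin.elim0 x hx

theorem negPartial (hf : CompletelyMonotoneOnOrthant f) (i : ι) :
    CompletelyMonotoneOnOrthant (negPartial i f) := by
  refine ⟨hf.1.negPartial, fun k idx x hx => ?_⟩
  have h := hf.2 (k + 1) (Fin.snoc (α := fun _ => ι) idx i) x hx
  have e : (fun j => (Pi.single (Fin.snoc (α := fun _ => ι) idx i j) (1 : ℝ) : ι → ℝ))
      = Fin.snoc (α := fun _ => ι → ℝ) (fun j => Pi.single (idx j) (1 : ℝ)) (Pi.single i 1) := by
    funext j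
    refine Fin.lastCases ?_ (fun j => ?_) j <;> simp
  rw [e] at h
  rw [iteratedFDerivWithin_negPartial hf.1 k _ i hx]
  rw [pow_succ] at h
  linarith

theorem add (hf : CompletelyMonotoneOnOrthant f) (hg : CompletelyMonotoneOnOrthant g) :
    CompletelyMonotoneOnOrthant (fun x => f x + g x) := by
  refine ⟨hf.1.add hg.1, fun k idx x hx => ?_⟩
  have h := iteratedFDerivWithin_add_apply (i := k) (x := x)
    ((hf.1.of_le (by exact_mod_cast le_top)).contDiffWithinAt hx)
    ((hg.1.of_le (by exact_mod_cast le_top)).contDiffWithinAt hx)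
    (isOpen_posOrthant (ι := ι)).uniqueDiffOn hx
  have h' : (fun x => f x + g x) = f + g := rfl
  rw [h', h, add_apply, mul_add]
  exact add_nonneg (hf.2 k idx x hx) (hg.2 k idx x hx)

theorem congr (hf : CompletelyMonotoneOnOrthant f) (h : Set.EqOn g f (posOrthant ι)) :
    CompletelyMonotoneOnOrthant g :=
  ⟨hf.1.congr h, fun k idx x hx => by
    rw [iteratedFDerivWithin_congr h hx]
    exact hf.2 k idx x hx⟩

theorem sum {α : Type*} (s : Finset α) {F : α → (ι → ℝ) → ℝ}
    (hF : ∀ a ∈ s, CompletelyMonotoneOnOrthant (F a)) :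
    CompletelyMonotoneOnOrthant (fun x => ∑ a ∈ s, F a x) := by
  classical
  induction s using Finset.induction_on with
  | empty =>
    refine ⟨by simpa using contDiffOn_const, fun k idx x hx => ?_⟩
    simp [iteratedFDerivWithin_fun_zero]
  | insert a s ha ih =>
    simp only [Finset.sum_insert ha]
    exact (hF a (by simp)).add (ih fun b hb => hF b (by simp [hb]))

/-- A class of smooth nonnegative functions that is stable under `negPartial` consists of
completely monotone functions. -/
theorem of_stable (P : ((ι → ℝ) → ℝ) → Prop)
    (hsmooth : ∀ f, P f → ContDiffOn ℝ (⊤ : ℕ∞) f (posOrthant ι))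
    (hnonneg : ∀ f, P f → ∀ x ∈ posOrthant ι, 0 ≤ f x)
    (hstable : ∀ f i, P f → P (_root_.negPartial i f)) (hf : P f) :
    CompletelyMonotoneOnOrthant f := by
  refine ⟨hsmooth f hf, fun k => ?_⟩
  induction k generalizing f with
  | zero => intro idx x hx; simpa using hnonneg f hf x hx
  | succ k ih =>
    intro idx x hx
    have h := ih (hstable f (idx (Fin.last k)) hf) (fun j => idx j.castSucc) x hx
    rw [iteratedFDerivWithin_negPartial (hsmooth f hf) k _ _ hx] at h
    have e : (Fin.snoc (α := fun _ => ι → ℝ) (fun j => Pi.single (idx j.castSucc) (1 : ℝ))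
        (Pi.single (idx (Fin.last k)) 1))
        = fun j => (Pi.single (idx j) (1 : ℝ) : ι → ℝ) := by
      funext j
      refine Fin.lastCases ?_ (fun j => ?_) j <;> simp
    rw [e] at h
    rw [pow_succ]
    linarith

end CompletelyMonotoneOnOrthant

/-- Nonnegativity on the orthant of the `n`-th order alternating differences of `f` in
nonnegative directions. -/
def NonnegDiff {ι : Type*} : ℕ → ((ι → ℝ) → ℝ) → Prop
  | 0, f => ∀ x ∈ posOrthant ι, 0 ≤ f x
  | n + 1, f => ∀ v : ι → ℝ, (∀ i, 0 ≤ v i) → NonnegDiff n (fun x => f x - f (x + v))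

namespace NonnegDiff

omit [Fintype ι] [DecidableEq ι]

variable {f g : (ι → ℝ) → ℝ} {n : ℕ}

theorem congr (hf : NonnegDiff n f) (h : Set.EqOn g f (posOrthant ι)) : NonnegDiff n g := by
  induction n generalizing f g with
  | zero => exact fun x hx => (hf x hx).trans_eq (h hx).symm
  | succ n ih =>
    exact fun v hv => ih (hf v hv) fun x hx => by
      simp only [h hx, h (posOrthant_add_mem hx hv)]

theorem const_mul (hf : NonnegDiff n f) {c : ℝ} (hc : 0 ≤ c) :
    NonnegDiff n (fun x => c * f x) := by
  induction n generalizing f with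
  | zero => exact fun x hx => mul_nonneg hc (hf x hx)
  | succ n ih => exact fun v hv => (ih (hf v hv)).congr fun x _ => by ring

theorem add (hf : NonnegDiff n f) (hg : NonnegDiff n g) : NonnegDiff n (fun x => f x + g x) := by
  induction n generalizing f g with
  | zero => exact fun x hx => add_nonneg (hf x hx) (hg x hx)
  | succ n ih => exact fun v hv => (ih (hf v hv) (hg v hv)).congr fun x _ => by ring

theorem shift (hf : NonnegDiff n f) {v : ι → ℝ} (hv : ∀ i, 0 ≤ v i) :
    NonnegDiff n (fun x => f (x + v)) := by
  induction n generalizing f with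
  | zero => exact fun x hx => hf _ (posOrthant_add_mem hx hv)
  | succ n ih => exact fun w hw => (ih (hf w hw)).congr fun x _ => by simp only [add_right_comm]

theorem mul (hf : ∀ n, NonnegDiff n f) (hg : ∀ n, NonnegDiff n g) (n : ℕ) :
    NonnegDiff n (fun x => f x * g x) := by
  induction n generalizing f g with
  | zero => exact fun x hx => mul_nonneg (hf 0 x hx) (hg 0 x hx)
  | succ n ih =>
    exact fun v hv => ((ih (fun m => hf (m + 1) v hv) hg).add
      (ih (fun m => (hf m).shift hv) (fun m => hg (m + 1) v hv))).congr fun x _ => by ring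

theorem of_tendsto {F : ℕ → (ι → ℝ) → ℝ} (hF : ∀ j, NonnegDiff n (F j))
    (h : ∀ x ∈ posOrthant ι, Tendsto (fun j => F j x) atTop (𝓝 (f x))) : NonnegDiff n f := by
  induction n generalizing f F with
  | zero => exact fun x hx => ge_of_tendsto' (h x hx) fun j => hF j x hx
  | succ n ih =>
    exact fun v hv => ih (fun j => hF j v hv) fun x hx =>
      (h x hx).sub (h _ (posOrthant_add_mem hx hv))

theorem integral {α : Type*} [MeasurableSpace α] {μ : Measure α} {F : α → (ι → ℝ) → ℝ}
    (hF : ∀ᵐ t ∂μ, NonnegDiff n (F t))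
    (h_int : ∀ x ∈ posOrthant ι, Integrable (fun t => F t x) μ) :
    NonnegDiff n (fun x => ∫ t, F t x ∂μ) := by
  induction n generalizing F with
  | zero => exact fun x hx => integral_nonneg_of_ae (hF.mono fun t ht => ht x hx)
  | succ n ih =>
    exact fun v hv => (ih (hF.mono fun t ht => ht v hv) fun x hx =>
      (h_int x hx).sub (h_int _ (posOrthant_add_mem hx hv))).congr fun x hx =>
        (integral_sub (h_int x hx) (h_int _ (posOrthant_add_mem hx hv))).symm

theorem exp_neg [Fintype ι] {a : ι → ℝ} (ha : ∀ i, 0 ≤ a i) (n : ℕ) :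
    NonnegDiff n (fun x : ι → ℝ => Real.exp (-∑ i, a i * x i)) := by
  induction n with
  | zero => exact fun x _ => (Real.exp_pos _).le
  | succ n ih =>
    intro v hv
    have h : Real.exp (-∑ i, a i * v i) ≤ 1 :=
      Real.exp_le_one_iff.2 (neg_nonpos.2 (Finset.sum_nonneg fun i _ => mul_nonneg (ha i) (hv i)))
    refine (ih.const_mul (sub_nonneg.2 h)).congr fun x _ => ?_
    simp only [Pi.add_apply, mul_add, Finset.sum_add_distrib, neg_add, Real.exp_add]
    ring

end NonnegDiff

theorem NonnegDiff.negPartial {f : (ι → ℝ) → ℝ} (hs : ContDiffOn ℝ (⊤ : ℕ∞) f (posOrthant ι))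
    (hf : ∀ n, NonnegDiff n f) (i : ι) (n : ℕ) : NonnegDiff n (negPartial i f) := by
  have hd : ∀ j : ℕ, ∀ k, 0 ≤ ((j : ℝ) + 1)⁻¹ • (Pi.single i (1 : ℝ) : ι → ℝ) k := fun j k =>
    mul_nonneg (by positivity) (by by_cases h : k = i <;> simp [h])
  refine NonnegDiff.of_tendsto
    (fun j => (hf (n + 1) (((j : ℝ) + 1)⁻¹ • Pi.single i (1 : ℝ)) (hd j)).const_mul
      (c := (j : ℝ) + 1) (by positivity)) fun x hx => ?_
  have hfx : HasFDerivAt f (fderiv ℝ f x) x :=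
    ((hs.contDiffAt (isOpen_posOrthant.mem_nhds hx)).differentiableAt (by simp)).hasFDerivAt
  have hc : Tendsto (fun j : ℕ => ‖(j : ℝ) + 1‖) atTop atTop :=
    tendsto_norm_atTop_atTop.comp (tendsto_natCast_atTop_atTop.atTop_add tendsto_const_nhds)
  have h := hfx.lim (v := Pi.single i (1 : ℝ)) (l := atTop) (c := fun j : ℕ => (j : ℝ) + 1) hc
  refine h.neg.congr fun j => ?_
  simp only [smul_eq_mul]
  ring

theorem CompletelyMonotoneOnOrthant.of_nonnegDiff {f : (ι → ℝ) → ℝ}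
    (hs : ContDiffOn ℝ (⊤ : ℕ∞) f (posOrthant ι)) (hf : ∀ n, NonnegDiff n f) :
    CompletelyMonotoneOnOrthant f :=
  of_stable (fun g => ContDiffOn ℝ (⊤ : ℕ∞) g (posOrthant ι) ∧ ∀ n, NonnegDiff n g)
    (fun _ h => h.1) (fun _ h => h.2 0) (fun _ i h => ⟨h.1.negPartial, NonnegDiff.negPartial h.1 h.2 i⟩)
    ⟨hs, hf⟩

end Orthant

section Sufficiency

theorem integral_exp_neg_quadratic {A : ℝ} (hA : 0 < A) (B C : ℝ) :
    ∫ v : ℝ, Real.exp (-(A * v ^ 2 - 2 * B * v + C))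
      = √(Real.pi / A) * Real.exp (B ^ 2 / A - C) := by
  have h : ∀ v : ℝ, Real.exp (-(A * v ^ 2 - 2 * B * v + C))
      = Real.exp (-A * (v - B / A) ^ 2) * Real.exp (B ^ 2 / A - C) := fun v => by
    rw [← Real.exp_add]
    congr 1
    field_simp
    ring
  simp_rw [h]
  rw [integral_mul_const, integral_sub_right_eq_self (fun v => Real.exp (-A * v ^ 2)) (B / A),
    integral_gaussian]

theorem integrable_exp_neg_quadratic {A : ℝ} (hA : 0 < A) (B C : ℝ) :
    Integrable fun v : ℝ => Real.exp (-(A * v ^ 2 - 2 * B * v + C)) := by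
  refine Integrable.of_integral_ne_zero ?_
  rw [integral_exp_neg_quadratic hA]
  positivity

theorem integrable_rpow_mul_exp_neg {a r : ℝ} (ha : 0 < a) (hr : 0 < r) :
    Integrable (fun t : ℝ => t ^ (a - 1) * Real.exp (-(r * t)))
      (volume.restrict (Set.Ioi 0)) := by
  refine Integrable.of_integral_ne_zero ?_
  rw [Real.integral_rpow_mul_exp_neg_mul_Ioi ha hr]
  have := Real.Gamma_pos_of_pos ha
  positivity

/-- Negative powers of a nonnegative linear form. -/
theorem NonnegDiff.linear_rpow_neg {ι : Type*} [Fintype ι] {a : ι → ℝ} (ha : ∀ i, 0 ≤ a i)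
    (hpos : ∀ x ∈ posOrthant ι, 0 < ∑ i, a i * x i) {s : ℝ} (hs : 0 ≤ s) (n : ℕ) :
    NonnegDiff n (fun x : ι → ℝ => (∑ i, a i * x i) ^ (-s)) := by
  rcases hs.eq_or_lt with rfl | hs
  · simpa using NonnegDiff.exp_neg (ι := ι) (a := 0) (fun _ => le_rfl) n
  have h : NonnegDiff n (fun x : ι → ℝ => ∫ t in Set.Ioi (0 : ℝ),
      t ^ (s - 1) * Real.exp (-((∑ i, a i * x i) * t))) := by
    refine NonnegDiff.integral ?_ fun x hx => integrable_rpow_mul_exp_neg hs (hpos x hx)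
    refine (ae_restrict_mem measurableSet_Ioi).mono fun t (ht : 0 < t) => ?_
    refine ((NonnegDiff.exp_neg (a := fun i => t * a i)
      (fun i => mul_nonneg ht.le (ha i)) n).const_mul (Real.rpow_nonneg ht.le (s - 1))).congr
        fun x _ => ?_
    simp only [Finset.sum_mul]
    congr 4
    funext i
    ring
  refine (h.const_mul (inv_nonneg.2 (Real.Gamma_pos_of_pos hs).le)).congr fun x hx => ?_
  have hg := (Real.Gamma_pos_of_pos hs).ne'
  simp only []
  rw [Real.integral_rpow_mul_exp_neg_mul_Ioi hs (hpos x hx), one_div,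
    Real.inv_rpow (hpos x hx).le, Real.rpow_neg (hpos x hx).le]
  field_simp

/-- The exponential kernel of `E_{2,4}` obtained by integrating exponentials of the linear forms
`x₃ + ∑ i < 3, xᵢ |w - pᵢ|²`, with `p₀ p₁ p₂` a unit equilateral triangle, over `w` in the plane. -/
theorem NonnegDiff.exp_neg_E24_div {s : ℝ} (hs : 0 < s) (n : ℕ) :
    NonnegDiff n (fun x : Fin 4 → ℝ => (x 0 + x 1 + x 2)⁻¹ *
      Real.exp (-((x 0 * x 1 + x 0 * x 2 + x 0 * x 3 + x 1 * x 2 + x 1 * x 3 + x 2 * x 3)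
        / (x 0 + x 1 + x 2) * s))) := by
  obtain ⟨r, hr⟩ : ∃ r : ℝ, r ^ 2 = 3 / 4 := ⟨√(3 / 4), Real.sq_sqrt (by norm_num)⟩
  have hd : ∀ x ∈ posOrthant (Fin 4), 0 < x 0 + x 1 + x 2 := fun x hx => by
    have := hx 0; have := hx 1; have := hx 2; positivity
  have h1 : ∀ u v : ℝ, NonnegDiff n (fun x : Fin 4 → ℝ =>
      Real.exp (-((s * (x 0 + x 1 + x 2)) * v ^ 2 - 2 * (s * (r * x 2)) * v
        + s * (x 3 + x 0 * u ^ 2 + x 1 * (u - 1) ^ 2 + x 2 * (u - 1 / 2) ^ 2 + x 2 * (3 / 4))))) := by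
    intro u v
    refine (NonnegDiff.exp_neg (a := ![s * (u ^ 2 + v ^ 2), s * ((u - 1) ^ 2 + v ^ 2),
      s * ((u - 1 / 2) ^ 2 + (v - r) ^ 2), s]) ?_ n).congr fun x _ => ?_
    · intro i
      fin_cases i <;> simp <;> positivity
    · simp only [Fin.sum_univ_four, Matrix.cons_val]
      rw [← hr]
      congr 1
      ring
  have h2 : ∀ u : ℝ, NonnegDiff n (fun x : Fin 4 → ℝ => √(Real.pi / (s * (x 0 + x 1 + x 2))) *
      Real.exp (-((s * (x 0 + x 1 + x 2)) * u ^ 2 - 2 * (s * (x 1 + x 2 / 2)) * u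
        + s * (x 3 + x 1 + x 2 - 3 / 4 * x 2 ^ 2 / (x 0 + x 1 + x 2))))) := by
    intro u
    refine (NonnegDiff.integral (μ := volume) (Eventually.of_forall fun v => h1 u v) fun x hx =>
      integrable_exp_neg_quadratic (mul_pos hs (hd x hx)) _ _).congr fun x hx => ?_
    have := hd x hx
    simp only []
    rw [integral_exp_neg_quadratic (mul_pos hs (hd x hx))]
    congr 2
    rw [← hr]
    field_simp
    rw [hr]
    ring
  have h3 := NonnegDiff.integral (μ := volume) (Eventually.of_forall h2) fun x hx =>
      (integrable_exp_neg_quadratic (mul_pos hs (hd x hx)) _ _).const_mul _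
  refine (h3.const_mul (c := s / Real.pi) (by positivity)).congr fun x hx => ?_
  have := hd x hx
  simp only []
  rw [integral_const_mul, integral_exp_neg_quadratic (mul_pos hs (hd x hx)), ← mul_assoc,
    ← mul_assoc, mul_assoc (s / Real.pi), Real.mul_self_sqrt (by positivity)]
  congr 1
  · field_simp
  · congr 1
    field_simp
    ring

theorem E24_pos {x : Fin 4 → ℝ} (hx : x ∈ posOrthant (Fin 4)) :
    0 < x 0 * x 1 + x 0 * x 2 + x 0 * x 3 + x 1 * x 2 + x 1 * x 3 + x 2 * x 3 := by
  have := hx 0; have := hx 1; have := hx 2; have := hx 3; positivity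

theorem contDiffOn_E24_rpow (s : ℝ) :
    ContDiffOn ℝ (⊤ : ℕ∞) (fun x : Fin 4 → ℝ =>
      (x 0 * x 1 + x 0 * x 2 + x 0 * x 3 + x 1 * x 2 + x 1 * x 3 + x 2 * x 3) ^ s)
      (posOrthant (Fin 4)) :=
  ContDiffOn.rpow_const_of_ne (by fun_prop) fun _ hx => (E24_pos hx).ne'

theorem NonnegDiff.E24_rpow_neg {β : ℝ} (hβ : 1 ≤ β) (n : ℕ) :
    NonnegDiff n (fun x : Fin 4 → ℝ =>
      (x 0 * x 1 + x 0 * x 2 + x 0 * x 3 + x 1 * x 2 + x 1 * x 3 + x 2 * x 3) ^ (-β)) := by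
  have hβ0 : 0 < β := by linarith
  have hd : ∀ x ∈ posOrthant (Fin 4), 0 < x 0 + x 1 + x 2 := fun x hx => by
    have := hx 0; have := hx 1; have := hx 2; positivity
  have h1 : ∀ n, NonnegDiff n (fun x : Fin 4 → ℝ => ∫ s in Set.Ioi (0 : ℝ),
      (x 0 + x 1 + x 2)⁻¹ * (s ^ (β - 1) *
        Real.exp (-((x 0 * x 1 + x 0 * x 2 + x 0 * x 3 + x 1 * x 2 + x 1 * x 3 + x 2 * x 3)
          / (x 0 + x 1 + x 2) * s)))) := by
    intro n
    refine NonnegDiff.integral ?_ fun x hx =>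
      (integrable_rpow_mul_exp_neg hβ0 (div_pos (E24_pos hx) (hd x hx))).const_mul _
    refine (ae_restrict_mem measurableSet_Ioi).mono fun s (hs : 0 < s) => ?_
    exact ((NonnegDiff.exp_neg_E24_div hs n).const_mul (Real.rpow_nonneg hs.le (β - 1))).congr
      fun x _ => by ring
  have h2 := NonnegDiff.linear_rpow_neg (ι := Fin 4) (a := ![1, 1, 1, 0])
    (fun i => by fin_cases i <;> simp)
    (fun x hx => by simpa [Fin.sum_univ_four] using hd x hx) (sub_nonneg.2 hβ)
  refine ((NonnegDiff.mul h1 h2 n).const_mul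
    (inv_nonneg.2 (Real.Gamma_pos_of_pos hβ0).le)).congr fun x hx => ?_
  have hg := (Real.Gamma_pos_of_pos hβ0).ne'
  have hE := E24_pos hx
  have hdx := hd x hx
  have hlin : ∑ i, (![1, 1, 1, 0] : Fin 4 → ℝ) i * x i = x 0 + x 1 + x 2 := by
    simp [Fin.sum_univ_four]
  simp only [hlin]
  rw [integral_const_mul, Real.integral_rpow_mul_exp_neg_mul_Ioi hβ0 (div_pos hE hdx), one_div,
    inv_div, Real.div_rpow hdx.le hE.le, Real.rpow_neg hE.le, neg_sub, Real.rpow_sub hdx,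
    Real.rpow_one]
  have := Real.rpow_pos_of_pos hdx β
  have := Real.rpow_pos_of_pos hE β
  field_simp

end Sufficiency

section Necessity

variable {ι : Type*} [Fintype ι] [DecidableEq ι]

theorem negPartial_sum {α : Type*} (s : Finset α) {F : α → (ι → ℝ) → ℝ} (i : ι)
    (hF : ∀ a ∈ s, ContDiffOn ℝ (⊤ : ℕ∞) (F a) (posOrthant ι)) :
    Set.EqOn (negPartial i fun x => ∑ a ∈ s, F a x)
      (fun x => ∑ a ∈ s, negPartial i (F a) x) (posOrthant ι) := fun x hx => by
  simp only [negPartial]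
  rw [fderiv_fun_sum fun a ha =>
    ((hF a ha).contDiffAt (isOpen_posOrthant.mem_nhds hx)).differentiableAt (by simp)]
  simp

theorem negPartial_comm {f : (ι → ℝ) → ℝ} (hf : ContDiffOn ℝ (⊤ : ℕ∞) f (posOrthant ι)) (i j : ι) :
    Set.EqOn (negPartial i (negPartial j f)) (negPartial j (negPartial i f)) (posOrthant ι) := by
  have h : ∀ i j : ι, ∀ x ∈ posOrthant ι, negPartial i (negPartial j f) x
      = fderiv ℝ (fderiv ℝ f) x (Pi.single i 1) (Pi.single j 1) := fun i j x hx => by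
    have hd : DifferentiableAt ℝ (fderiv ℝ f) x :=
      ((hf.fderiv_of_isOpen isOpen_posOrthant (m := (⊤ : ℕ∞)) (by simp)).contDiffAt
        (isOpen_posOrthant.mem_nhds hx)).differentiableAt (by simp)
    have hj : negPartial j f = fun y => -(fderiv ℝ f y (Pi.single j 1)) := rfl
    rw [negPartial, hj, fderiv_fun_neg, fderiv_clm_apply hd (differentiableAt_const _)]
    simp
  intro x hx
  rw [h i j x hx, h j i x hx]
  exact ((hf.contDiffAt (isOpen_posOrthant.mem_nhds hx)).isSymmSndFDerivAt
    (by
      rw [minSmoothness_of_isRCLikeNormedField]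
      exact WithTop.coe_le_coe.2 (le_top : (2 : ℕ∞) ≤ ⊤))).eq _ _

/-- The second-order operator `∑ (i, j) ∈ S, ∂ᵢ ∂ⱼ`. -/
noncomputable def sumSndPartial (S : Finset (ι × ι)) (f : (ι → ℝ) → ℝ) (x : ι → ℝ) : ℝ :=
  ∑ p ∈ S, negPartial p.1 (negPartial p.2 f) x

variable {f g : (ι → ℝ) → ℝ}

theorem sumSndPartial_congr (S : Finset (ι × ι)) (h : Set.EqOn f g (posOrthant ι)) :
    Set.EqOn (sumSndPartial S f) (sumSndPartial S g) (posOrthant ι) := fun _ hx =>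
  Finset.sum_congr rfl fun _ _ => negPartial_congr (negPartial_congr h) hx

theorem ContDiffOn.sumSndPartial (S : Finset (ι × ι))
    (hf : ContDiffOn ℝ (⊤ : ℕ∞) f (posOrthant ι)) :
    ContDiffOn ℝ (⊤ : ℕ∞) (sumSndPartial S f) (posOrthant ι) :=
  ContDiffOn.sum fun _ _ => hf.negPartial.negPartial

theorem CompletelyMonotoneOnOrthant.sumSndPartial (S : Finset (ι × ι))
    (hf : CompletelyMonotoneOnOrthant f) : CompletelyMonotoneOnOrthant (sumSndPartial S f) :=
  CompletelyMonotoneOnOrthant.sum S fun p _ => (hf.negPartial p.2).negPartial p.1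

theorem sumSndPartial_comm (S T : Finset (ι × ι)) (hf : ContDiffOn ℝ (⊤ : ℕ∞) f (posOrthant ι)) :
    Set.EqOn (sumSndPartial S (sumSndPartial T f)) (sumSndPartial T (sumSndPartial S f))
      (posOrthant ι) := by
  have h : ∀ S T : Finset (ι × ι), ∀ x ∈ posOrthant ι, sumSndPartial S (sumSndPartial T f) x
      = ∑ p ∈ S, ∑ q ∈ T,
        negPartial p.1 (negPartial p.2 (negPartial q.1 (negPartial q.2 f))) x := by
    intro S T x hx
    refine Finset.sum_congr rfl fun p _ => ?_
    have h1 := negPartial_sum T p.2 (F := fun q => negPartial q.1 (negPartial q.2 f))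
      fun _ _ => hf.negPartial.negPartial
    refine (negPartial_congr h1 hx).trans ?_
    exact negPartial_sum T p.1
      (F := fun q => negPartial p.2 (negPartial q.1 (negPartial q.2 f)))
      (fun _ _ => hf.negPartial.negPartial.negPartial) hx
  intro x hx
  rw [h S T x hx, h T S x hx, Finset.sum_comm]
  refine Finset.sum_congr rfl fun q _ => Finset.sum_congr rfl fun p _ => ?_
  have move : ∀ k : ι, Set.EqOn (negPartial k (negPartial q.1 (negPartial q.2 f)))
      (negPartial q.1 (negPartial q.2 (negPartial k f))) (posOrthant ι) := fun k y hy =>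
    (negPartial_comm hf.negPartial k q.1 hy).trans (negPartial_congr (negPartial_comm hf k q.2) hy)
  refine (negPartial_congr (move p.2) hx).trans ?_
  refine (negPartial_comm hf.negPartial.negPartial p.1 q.1 hx).trans ?_
  refine negPartial_congr (fun y hy => ?_) hx
  exact negPartial_comm hf.negPartial p.1 q.2 hy

theorem ContDiffOn.iterate_sumSndPartial (S : Finset (ι × ι))
    (hf : ContDiffOn ℝ (⊤ : ℕ∞) f (posOrthant ι)) (k : ℕ) :
    ContDiffOn ℝ (⊤ : ℕ∞) ((_root_.sumSndPartial S)^[k] f) (posOrthant ι) := by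
  induction k with
  | zero => exact hf
  | succ k ih => rw [Function.iterate_succ_apply']; exact ih.sumSndPartial S

theorem CompletelyMonotoneOnOrthant.iterate_sumSndPartial (S : Finset (ι × ι))
    (hf : CompletelyMonotoneOnOrthant f) (k : ℕ) :
    CompletelyMonotoneOnOrthant ((_root_.sumSndPartial S)^[k] f) := by
  induction k with
  | zero => exact hf
  | succ k ih => rw [Function.iterate_succ_apply']; exact ih.sumSndPartial S

theorem iterate_sumSndPartial_comm (S T : Finset (ι × ι))
    (hf : ContDiffOn ℝ (⊤ : ℕ∞) f (posOrthant ι)) (k : ℕ) :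
    Set.EqOn ((sumSndPartial S)^[k] (sumSndPartial T f)) (sumSndPartial T ((sumSndPartial S)^[k] f))
      (posOrthant ι) := by
  induction k with
  | zero => exact fun _ _ => rfl
  | succ k ih =>
    simp only [Function.iterate_succ_apply']
    exact (sumSndPartial_congr S ih).trans
      (sumSndPartial_comm S T (hf.iterate_sumSndPartial S k))

/-- `f` is homogeneous of degree `-γ` on the orthant. -/
def HomogeneousNeg (γ : ℝ) (f : (ι → ℝ) → ℝ) : Prop :=
  ∀ x ∈ posOrthant ι, ∀ t : ℝ, 0 < t → f (t • x) = t ^ (-γ) * f x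

omit [Fintype ι] [DecidableEq ι] in
theorem smul_mem_posOrthant {x : ι → ℝ} (hx : x ∈ posOrthant ι) {t : ℝ} (ht : 0 < t) :
    t • x ∈ posOrthant ι := fun i => mul_pos ht (hx i)

theorem HomogeneousNeg.negPartial {γ : ℝ} (h : HomogeneousNeg γ f)
    (hf : ContDiffOn ℝ (⊤ : ℕ∞) f (posOrthant ι)) (i : ι) :
    HomogeneousNeg (γ + 1) (negPartial i f) := by
  intro x hx t ht
  have hd : ∀ y ∈ posOrthant ι, HasFDerivAt f (fderiv ℝ f y) y := fun y hy =>
    ((hf.contDiffAt (isOpen_posOrthant.mem_nhds hy)).differentiableAt (by simp)).hasFDerivAt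
  have h1 : HasFDerivAt (fun y => f (t • y)) (t • fderiv ℝ f (t • x)) x := by
    have := (hd _ (smul_mem_posOrthant hx ht)).comp x ((hasFDerivAt_id x).const_smul t)
    convert! this using 1
    ext v
    simp
  have h2 : HasFDerivAt (fun y => f (t • y)) (t ^ (-γ) • fderiv ℝ f x) x :=
    ((hd x hx).const_mul (t ^ (-γ))).congr_of_eventuallyEq
      (Filter.eventually_of_mem (isOpen_posOrthant.mem_nhds hx) fun y hy => h y hy t ht)
  have h3 := DFunLike.congr_fun (h1.unique h2) (Pi.single i 1)
  simp only [smul_apply, smul_eq_mul] at h3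
  simp only [_root_.negPartial]
  rw [neg_add, Real.rpow_add ht, Real.rpow_neg_one]
  field_simp
  linarith

theorem HomogeneousNeg.sumSndPartial {γ : ℝ} (h : HomogeneousNeg γ f)
    (hf : ContDiffOn ℝ (⊤ : ℕ∞) f (posOrthant ι)) (S : Finset (ι × ι)) :
    HomogeneousNeg (γ + 2) (sumSndPartial S f) := by
  intro x hx t ht
  simp only [_root_.sumSndPartial, Finset.mul_sum]
  refine Finset.sum_congr rfl fun p _ => ?_
  rw [(h.negPartial hf p.2).negPartial hf.negPartial p.1 x hx t ht]
  ring_nf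

theorem HomogeneousNeg.iterate_sumSndPartial {γ : ℝ} (h : HomogeneousNeg γ f)
    (hf : ContDiffOn ℝ (⊤ : ℕ∞) f (posOrthant ι)) (S : Finset (ι × ι)) (k : ℕ) :
    HomogeneousNeg (γ + 2 * k) ((_root_.sumSndPartial S)^[k] f) := by
  induction k with
  | zero => simpa using h
  | succ k ih =>
    rw [Function.iterate_succ_apply']
    convert ih.sumSndPartial (hf.iterate_sumSndPartial S k) S using 1
    push_cast
    ring

omit [Fintype ι] [DecidableEq ι] in
theorem one_mem_posOrthant : (1 : ι → ℝ) ∈ posOrthant ι := fun _ => one_pos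

/-- Euler's identity at the point `(1, …, 1)`. -/
theorem HomogeneousNeg.sum_negPartial_one {γ : ℝ} (h : HomogeneousNeg γ f)
    (hf : ContDiffOn ℝ (⊤ : ℕ∞) f (posOrthant ι)) :
    ∑ i, _root_.negPartial i f 1 = γ * f 1 := by
  have hd : HasFDerivAt f (fderiv ℝ f ((1 : ℝ) • (1 : ι → ℝ))) ((1 : ℝ) • (1 : ι → ℝ)) := by
    rw [one_smul]
    exact ((hf.contDiffAt (isOpen_posOrthant.mem_nhds one_mem_posOrthant)).differentiableAt
      (by simp)).hasFDerivAt
  have h1 := hd.comp_hasDerivAt (1 : ℝ) ((hasDerivAt_id (1 : ℝ)).smul_const (1 : ι → ℝ))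
  have h2 : HasDerivAt (fun t : ℝ => t ^ (-γ) * f 1) (-γ * 1 ^ (-γ - 1) * f 1) 1 :=
    (Real.hasDerivAt_rpow_const (Or.inl one_ne_zero)).mul_const _
  have h3 := h1.unique (h2.congr_of_eventuallyEq
    (Filter.eventually_of_mem (Ioi_mem_nhds one_pos) fun t ht => h 1 one_mem_posOrthant t ht))
  simp only [one_smul, Real.one_rpow, mul_one] at h3
  have h4 : (1 : ι → ℝ) = ∑ i, Pi.single i (1 : ℝ) := by
    ext j; simp [Finset.sum_apply, Pi.single_apply]
  have h5 : fderiv ℝ f 1 1 = ∑ i, fderiv ℝ f 1 (Pi.single i 1) := by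
    conv_lhs => rw [h4]
    rw [map_sum, ← h4]
  simp only [_root_.negPartial, Finset.sum_neg_distrib]
  linarith

theorem HomogeneousNeg.sumSndPartial_univ_one {γ : ℝ} (h : HomogeneousNeg γ f)
    (hf : ContDiffOn ℝ (⊤ : ℕ∞) f (posOrthant ι)) :
    _root_.sumSndPartial Finset.univ f 1 = γ * (γ + 1) * f 1 := by
  rw [_root_.sumSndPartial, Fintype.sum_prod_type_right]
  simp only [(h.negPartial hf _).sum_negPartial_one hf.negPartial]
  rw [← Finset.mul_sum, h.sum_negPartial_one hf]
  ring

theorem sumSndPartial_diag_add_offDiag (f : (ι → ℝ) → ℝ) (x : ι → ℝ) :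
    sumSndPartial Finset.univ.diag f x + sumSndPartial Finset.univ.offDiag f x
      = sumSndPartial Finset.univ f x := by
  simp only [sumSndPartial]
  rw [← Finset.sum_union (Finset.disjoint_diag_offDiag _), Finset.diag_union_offDiag,
    Finset.univ_product_univ]

/-- A second-moment inequality for homogeneous completely monotone functions. -/
theorem CompletelyMonotoneOnOrthant.sq_laplacian_le (hf : CompletelyMonotoneOnOrthant f) {γ : ℝ}
    (hγ : 0 < γ) (h : HomogeneousNeg γ f) :
    (_root_.sumSndPartial Finset.univ.diag f 1) ^ 2 * ((γ + 2) * (γ + 3))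
      ≤ f 1 * _root_.sumSndPartial Finset.univ.diag
          (_root_.sumSndPartial Finset.univ.diag f) 1 * (γ * (γ + 1)) := by
  let D := _root_.sumSndPartial (Finset.univ.diag : Finset (ι × ι))
  let O := _root_.sumSndPartial (Finset.univ.offDiag : Finset (ι × ι))
  let P : ℕ → ℝ := fun n => ∏ j ∈ Finset.range n, (γ + 2 * j) * (γ + 2 * j + 1)
  have hP : ∀ n, 0 < P n := fun n => Finset.prod_pos fun j _ => by positivity
  have key := hausdorff_moment_sq_le (fun k m => (D^[k] (O^[m] f)) 1 / P (k + m))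
    (fun k m => div_nonneg (((hf.iterate_sumSndPartial _ m).iterate_sumSndPartial _ k).nonneg
      one_mem_posOrthant) (hP _).le) (fun k m => by
      have hs := hf.1.iterate_sumSndPartial Finset.univ.offDiag m
      have hh := (h.iterate_sumSndPartial hf.1 Finset.univ.offDiag m).iterate_sumSndPartial hs
        Finset.univ.diag k
      have e1 : (D^[k + 1] (O^[m] f)) 1 = D (D^[k] (O^[m] f)) 1 := by
        rw [Function.iterate_succ_apply']
      have e2 : (D^[k] (O^[m + 1] f)) 1 = O (D^[k] (O^[m] f)) 1 := by
        rw [Function.iterate_succ_apply']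
        exact iterate_sumSndPartial_comm _ _ hs k one_mem_posOrthant
      have e3 : P (k + m + 1) = P (k + m) * ((γ + 2 * (k + m)) * (γ + 2 * (k + m) + 1)) := by
        simp only [P, Finset.prod_range_succ]
        push_cast
        ring
      have e4 := hh.sumSndPartial_univ_one (hs.iterate_sumSndPartial Finset.univ.diag k)
      rw [← sumSndPartial_diag_add_offDiag] at e4
      rw [e1, e2, show k + 1 + m = k + m + 1 by ring, show k + (m + 1) = k + m + 1 by ring, e3,
        ← add_div]
      refine (congrArg (· / _) e4).trans ?_
      have := hP (k + m)
      have : 0 < γ + 2 * m + 2 * k := by positivity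
      rw [show γ + 2 * ((k : ℝ) + m) = γ + 2 * m + 2 * k by ring]
      simp only [D, O]
      field_simp)
  simp only [P, Function.iterate_succ_apply, Function.iterate_zero_apply, Finset.prod_range_succ,
    Finset.prod_range_zero, Nat.cast_zero, Nat.cast_one, add_zero, mul_zero, mul_one, one_mul,
    div_one, D, div_pow] at key
  rw [← mul_div_assoc, div_le_div_iff₀ (by positivity) (by positivity)] at key
  have hpos : 0 < γ * (γ + 1) := by positivity
  refine le_of_mul_le_mul_right ?_ hpos
  linarith

/-- The second pure partial derivative along a line on which `f` is a quadratic polynomial times a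
power of an affine function. -/
theorem negPartial_negPartial_of_line (hf : ContDiffOn ℝ (⊤ : ℕ∞) f (posOrthant ι)) {i : ι}
    {x : ι → ℝ} (hx : x ∈ posOrthant ι) {q₀ q₁ q₂ a b s : ℝ} (ha : 0 < a)
    (hline : ∀ᶠ t : ℝ in 𝓝 0, f (x + t • Pi.single i 1)
      = (q₀ + q₁ * t + q₂ * t ^ 2) * (a + b * t) ^ (-s)) :
    negPartial i (negPartial i f) x
      = 2 * q₂ * a ^ (-s) - 2 * s * q₁ * b * a ^ (-s - 1) + s * (s + 1) * q₀ * b ^ 2 * a ^ (-s - 2) := by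
  have hcont : Continuous fun t : ℝ => x + t • (Pi.single i 1 : ι → ℝ) := by fun_prop
  have hO : ∀ᶠ t : ℝ in 𝓝 0, x + t • (Pi.single i 1 : ι → ℝ) ∈ posOrthant ι :=
    hcont.continuousAt.eventually_mem (isOpen_posOrthant.mem_nhds (by simpa using hx))
  have hpos : ∀ᶠ t : ℝ in 𝓝 0, 0 < a + b * t := by
    have : Continuous fun t : ℝ => a + b * t := by fun_prop
    exact this.continuousAt.eventually_mem (Ioi_mem_nhds (by simpa using ha))
  have hd : ∀ g : (ι → ℝ) → ℝ, ContDiffOn ℝ (⊤ : ℕ∞) g (posOrthant ι) → ∀ t : ℝ,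
      x + t • (Pi.single i 1 : ι → ℝ) ∈ posOrthant ι →
      HasDerivAt (fun t : ℝ => g (x + t • (Pi.single i 1 : ι → ℝ)))
        (-negPartial i g (x + t • Pi.single i 1)) t := by
    intro g hg t ht
    have h1 : HasFDerivAt g _ (x + t • Pi.single i 1) :=
      ((hg.contDiffAt (isOpen_posOrthant.mem_nhds ht)).differentiableAt (by simp)).hasFDerivAt
    have h2 := h1.comp_hasDerivAt t (((hasDerivAt_id t).smul_const (Pi.single i 1)).const_add x)
    simpa [negPartial, Function.comp_def] using h2
  have hlin : ∀ t : ℝ, HasDerivAt (fun t : ℝ => a + b * t) b t := fun t => by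
    simpa using ((hasDerivAt_id t).const_mul b).const_add a
  have hq : ∀ t : ℝ, HasDerivAt (fun t : ℝ => q₀ + q₁ * t + q₂ * t ^ 2) (q₁ + q₂ * (2 * t)) t :=
    fun t => by
      simpa using (((hasDerivAt_id t).const_mul q₁).const_add q₀).fun_add
        (((hasDerivAt_id t).pow 2).const_mul q₂)
  have hq' : ∀ t : ℝ, HasDerivAt (fun t : ℝ => q₁ + q₂ * (2 * t)) (q₂ * 2) t := fun t => by
    simpa using ((((hasDerivAt_id t).const_mul 2).const_mul q₂).const_add q₁)
  have hpow : ∀ (r t : ℝ), 0 < a + b * t →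
      HasDerivAt (fun t : ℝ => (a + b * t) ^ r) (b * r * (a + b * t) ^ (r - 1)) t :=
    fun r t ht => (hlin t).rpow_const (Or.inl ht.ne')
  have hfirst : ∀ᶠ t : ℝ in 𝓝 0, negPartial i f (x + t • Pi.single i 1)
      = -((q₁ + q₂ * (2 * t)) * (a + b * t) ^ (-s)
        + (q₀ + q₁ * t + q₂ * t ^ 2) * (b * -s * (a + b * t) ^ (-s - 1))) := by
    filter_upwards [hO, hpos, hline.eventually_nhds] with t h1 h2 h3
    have := (hd f hf t h1).unique (((hq t).mul (hpow (-s) t h2)).congr_of_eventuallyEq h3)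
    linarith
  have h0 : 0 < a + b * 0 := by simpa using ha
  have hsecond := (hd _ (hf.negPartial (i := i)) 0 (by simpa using hx)).unique
    ((((hq' 0).mul (hpow (-s) 0 h0)).add ((hq 0).mul ((hpow (-s - 1) 0 h0).const_mul
      (b * -s)))).neg.congr_of_eventuallyEq hfirst)
  simp only [zero_smul, add_zero, mul_zero, ne_eq, OfNat.ofNat_ne_zero, not_false_eq_true,
    zero_pow] at hsecond
  rw [show -s - 1 - 1 = -s - 2 by ring] at hsecond
  linarith

theorem sumSndPartial_diag (f : (ι → ℝ) → ℝ) (x : ι → ℝ) :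
    sumSndPartial Finset.univ.diag f x = ∑ i, negPartial i (negPartial i f) x := by
  rw [sumSndPartial, Finset.sum_diag]

theorem laplacian_E24_rpow_neg (β : ℝ) {x : Fin 4 → ℝ} (hx : x ∈ posOrthant (Fin 4)) :
    sumSndPartial Finset.univ.diag (fun x : Fin 4 → ℝ =>
      (x 0 * x 1 + x 0 * x 2 + x 0 * x 3 + x 1 * x 2 + x 1 * x 3 + x 2 * x 3) ^ (-β)) x
      = β * (β + 1) * (∑ i, ((∑ j, x j) - x i) ^ 2) *
        (x 0 * x 1 + x 0 * x 2 + x 0 * x 3 + x 1 * x 2 + x 1 * x 3 + x 2 * x 3) ^ (-β - 2) := by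
  rw [sumSndPartial_diag, mul_assoc, Finset.sum_mul, Finset.mul_sum]
  refine Finset.sum_congr rfl fun i _ => ?_
  rw [negPartial_negPartial_of_line (contDiffOn_E24_rpow (-β)) hx (q₀ := 1) (q₁ := 0) (q₂ := 0)
    (b := (∑ j, x j) - x i) (s := β) (E24_pos hx)]
  · ring
  · refine Eventually.of_forall fun t => ?_
    simp only [zero_mul, add_zero, one_mul]
    congr 1
    fin_cases i <;> simp [Fin.sum_univ_four] <;> ring

theorem laplacian_laplacian_E24_rpow_neg_one (β : ℝ) :
    sumSndPartial Finset.univ.diag (sumSndPartial Finset.univ.diag (fun x : Fin 4 → ℝ =>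
      (x 0 * x 1 + x 0 * x 2 + x 0 * x 3 + x 1 * x 2 + x 1 * x 3 + x 2 * x 3) ^ (-β))) 1
      = β * (β + 1) * (36 * (β + 1) * (β + 2) + 24) * 6 ^ (-β - 2) := by
  have hs := (contDiffOn_E24_rpow (-β)).sumSndPartial Finset.univ.diag
  rw [sumSndPartial_diag]
  have h : ∀ i : Fin 4, ∀ᶠ t : ℝ in 𝓝 0, sumSndPartial Finset.univ.diag (fun x : Fin 4 → ℝ =>
      (x 0 * x 1 + x 0 * x 2 + x 0 * x 3 + x 1 * x 2 + x 1 * x 3 + x 2 * x 3) ^ (-β))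
        (1 + t • Pi.single i 1)
      = (β * (β + 1) * 36 + β * (β + 1) * 18 * t + β * (β + 1) * 3 * t ^ 2)
        * (6 + 3 * t) ^ (-(β + 2)) := by
    intro i
    have hcont : Continuous fun t : ℝ => (1 : Fin 4 → ℝ) + t • (Pi.single i 1 : Fin 4 → ℝ) := by
      fun_prop
    filter_upwards [hcont.continuousAt.eventually_mem (isOpen_posOrthant.mem_nhds
      (by simpa using one_mem_posOrthant))] with t ht
    rw [laplacian_E24_rpow_neg β ht, show -(β + 2) = -β - 2 by ring]
    congr 1
    · fin_cases i <;> simp [Fin.sum_univ_four] <;> ring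
    · congr 1
      fin_cases i <;> simp <;> ring
  simp only [negPartial_negPartial_of_line hs one_mem_posOrthant (by norm_num : (0 : ℝ) < 6) (h _)]
  have e1 : (6 : ℝ) ^ (-(β + 2) - 1) = 6 ^ (-β - 2) / 6 := by
    rw [Real.rpow_sub_one (by norm_num)]
    congr 2
    ring
  have e2 : (6 : ℝ) ^ (-(β + 2) - 2) = 6 ^ (-β - 2) / 36 := by
    rw [Real.rpow_sub (by norm_num), show -(β + 2) = -β - 2 by ring]
    norm_num
  rw [e1, e2, show -(β + 2) = -β - 2 by ring]
  simp only [Finset.sum_const, Finset.card_univ, Fintype.card_fin, nsmul_eq_mul]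
  push_cast
  ring

theorem homogeneousNeg_E24_rpow_neg (β : ℝ) : HomogeneousNeg (2 * β) (fun x : Fin 4 → ℝ =>
    (x 0 * x 1 + x 0 * x 2 + x 0 * x 3 + x 1 * x 2 + x 1 * x 3 + x 2 * x 3) ^ (-β)) := by
  intro x hx t ht
  have h : -(2 * β) = 2 * (-β) := by ring
  rw [h, Real.rpow_mul ht.le, ← Real.mul_rpow (by positivity) (E24_pos hx).le]
  simp only [Pi.smul_apply, smul_eq_mul, Real.rpow_two]
  congr 1
  ring

theorem CompletelyMonotoneOnOrthant.eq_zero_or_one_le_of_E24 {β : ℝ}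
    (h : CompletelyMonotoneOnOrthant (fun x : Fin 4 → ℝ =>
      (x 0 * x 1 + x 0 * x 2 + x 0 * x 3 + x 1 * x 2 + x 1 * x 3 + x 2 * x 3) ^ (-β))) :
    β = 0 ∨ 1 ≤ β := by
  have hone : (0 : ℝ) < 6 ^ (-β) := by positivity
  have hval : (((1 : Fin 4 → ℝ) 0 * (1 : Fin 4 → ℝ) 1 + (1 : Fin 4 → ℝ) 0 * (1 : Fin 4 → ℝ) 2
      + (1 : Fin 4 → ℝ) 0 * (1 : Fin 4 → ℝ) 3 + (1 : Fin 4 → ℝ) 1 * (1 : Fin 4 → ℝ) 2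
      + (1 : Fin 4 → ℝ) 1 * (1 : Fin 4 → ℝ) 3 + (1 : Fin 4 → ℝ) 2 * (1 : Fin 4 → ℝ) 3) : ℝ) = 6 := by
    norm_num
  have hβ : 0 ≤ β := by
    have h1 := (homogeneousNeg_E24_rpow_neg β).sum_negPartial_one h.1
    have h2 := Finset.sum_nonneg fun i (_ : i ∈ Finset.univ) =>
      (h.negPartial i).nonneg one_mem_posOrthant
    simp only [h1, hval] at h2
    nlinarith
  rcases hβ.eq_or_lt with h0 | h0
  · exact Or.inl h0.symm
  refine Or.inr ?_
  have key := h.sq_laplacian_le (by linarith) (homogeneousNeg_E24_rpow_neg β)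
  rw [laplacian_laplacian_E24_rpow_neg_one, laplacian_E24_rpow_neg β one_mem_posOrthant] at key
  simp only [hval] at key
  have e : (6 : ℝ) ^ (-β - 2) = 6 ^ (-β) / 36 := by
    rw [Real.rpow_sub (by norm_num)]
    norm_num
  simp only [Fin.sum_univ_four, Pi.one_apply, e] at key
  generalize (6 : ℝ) ^ (-β) = c at key hone
  have hpos : 0 < c ^ 2 * (β ^ 2 * (β + 1) ^ 2) := by positivity
  have hid : 0 ≤ c ^ 2 * (β ^ 2 * (β + 1) ^ 2) * (β - 1) := by nlinarith [key]
  linarith [nonneg_of_mul_nonneg_right hid hpos]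

end Necessity

/-- With
`E_{2,4}(x_1,x_2,x_3,x_4) = x_1x_2 + x_1x_3 + x_1x_4 + x_2x_3 + x_2x_4 + x_3x_4`,
the function `E_{2,4}^{-β}` is completely monotone on `(0,∞)^4` iff `β = 0` or `β ≥ 1`. -/
theorem inverse_power_E24_completely_monotone_iff (β : ℝ) :
    CompletelyMonotoneOnOrthant
      (fun x : Fin 4 → ℝ =>
        (x 0 * x 1 + x 0 * x 2 + x 0 * x 3 + x 1 * x 2 + x 1 * x 3 + x 2 * x 3) ^ (-β))
      ↔ (β = 0 ∨ 1 ≤ β) := by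
  refine ⟨fun h => h.eq_zero_or_one_le_of_E24, ?_⟩
  rintro (rfl | hβ)
  · refine .of_nonnegDiff (contDiffOn_E24_rpow (-0)) fun n => ?_
    simpa using NonnegDiff.exp_neg (ι := Fin 4) (a := 0) (fun _ => le_rfl) n
  · exact .of_nonnegDiff (contDiffOn_E24_rpow (-β)) (NonnegDiff.E24_rpow_neg hβ)
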